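/- Let k be a field, S = k[X_0,…,X_d], and let I be a nonzero proper radical ideal of S, with h the largest height of a minimal prime of I. Then the resurgence ρ(I) = sup{ m/r : m, r positive integers with I^{(m)} ⊄ I^r } satisfies ρ(I) ≤ h; equivalently, for all positive integers m, r with I^{(m)} ⊄ I^r one has m/r ≤ h. -/

import Mathlib

/-- The `n`-th symbolic power of an ideal `I`: the intersection, over the minimal primes
`q` of `I`, of the contractions of `I^n R_q` along the localization maps `R → R_q`
(an element lies in the contraction of `I^n R_q` iff it is multiplied into `I^n` by
some element outside `q`). -/
noncomputable def symbolicPower {R : Type*} [CommRing R] (I : Ideal R) (n : ℕ) : Ideal R where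
  carrier := {x | ∀ q ∈ I.minimalPrimes, ∃ s ∉ q, s * x ∈ I ^ n}
  zero_mem' := by
    intro q hq
    exact ⟨1, fun h => hq.1.1.ne_top ((Ideal.eq_top_iff_one q).2 h), by
      simp⟩
  add_mem' := by
    intro x y hx hy q hq
    obtain ⟨s, hs, hsx⟩ := hx q hq
    obtain ⟨t, ht, hty⟩ := hy q hq
    refine ⟨s * t, fun h => (hq.1.1.mem_or_mem h).elim hs ht, ?_⟩
    have h1 : s * t * (x + y) = t * (s * x) + s * (t * y) := by ring
    rw [h1]
    exact Ideal.add_mem _ (Ideal.mul_mem_left _ _ hsx) (Ideal.mul_mem_left _ _ hty)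
  smul_mem' := by
    intro c x hx q hq
    obtain ⟨s, hs, hsx⟩ := hx q hq
    refine ⟨s, hs, ?_⟩
    have h1 : s * (c • x) = c * (s * x) := by rw [smul_eq_mul]; ring
    rw [h1]
    exact Ideal.mul_mem_left _ _ hsx

theorem mem_symbolicPower_iff {R : Type*} [CommRing R] (I : Ideal R) (n : ℕ) (x : R) :
    x ∈ symbolicPower I n ↔ ∀ q ∈ I.minimalPrimes, ∃ s ∉ q, s * x ∈ I ^ n :=
  Iff.rfl

theorem symbolicPower_mul_mem {R : Type*} [CommRing R] (I : Ideal R) {i j : ℕ} {x y : R}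
    (hx : x ∈ symbolicPower I i) (hy : y ∈ symbolicPower I j) :
    x * y ∈ symbolicPower I (i + j) := by
  intro q hq
  obtain ⟨s, hs, hsx⟩ := hx q hq
  obtain ⟨t, ht, hty⟩ := hy q hq
  refine ⟨s * t, fun h => (hq.1.1.mem_or_mem h).elim hs ht, ?_⟩
  have h1 : s * t * (x * y) = (s * x) * (t * y) := by ring
  rw [h1, pow_add]
  exact Ideal.mul_mem_mul hsx hty

theorem mem_symbolicPower_zero {R : Type*} [CommRing R] (I : Ideal R) (x : R) :
    x ∈ symbolicPower I 0 := by
  intro q hq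
  exact ⟨1, fun h => hq.1.1.ne_top ((Ideal.eq_top_iff_one q).2 h), by simp [Ideal.one_eq_top]⟩

/-- The height of an ideal: the infimum of the heights (in the prime spectrum,
ordered by inclusion) of the primes containing it. -/
noncomputable def idealHeight {R : Type*} [CommRing R] (I : Ideal R) : ℕ∞ :=
  ⨅ (p : PrimeSpectrum R) (_ : I ≤ p.asIdeal), Order.height p

section helpers
open MvPolynomial


/-- The ideal generated by the elements `t` multiplying `I` into an ideal generated by
`h` elements of `I`. -/
noncomputable def tIdeal {R : Type*} [CommRing R] (h : ℕ) (I : Ideal R) : Ideal R :=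
  Ideal.span {t | ∃ g : Fin h → R, (∀ l, g l ∈ I) ∧ ∀ x ∈ I, t * x ∈ Ideal.span (Set.range g)}

/-- remainder of exponents -/
noncomputable def emod {n : ℕ} (q : ℕ) (γ : Fin n →₀ ℕ) : Fin n →₀ ℕ :=
  γ.mapRange (· % q) (Nat.zero_mod q)

/-- quotient of exponents -/
noncomputable def ediv {n : ℕ} (q : ℕ) (γ : Fin n →₀ ℕ) : Fin n →₀ ℕ :=
  γ.mapRange (· / q) (Nat.zero_div q)

section frob
variable {κ : Type*} [Field κ] {n : ℕ}

/-- coordinates of a polynomial with respect to the basis `x^α` over `κ[x^q]`. -/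
noncomputable def fcoord (q : ℕ) (α : Fin n → Fin q) :
    MvPolynomial (Fin n) κ →ₗ[κ] MvPolynomial (Fin n) κ :=
  (basisMonomials (Fin n) κ).constr κ
    (fun γ => if (∀ i, emod q γ i = α i) then monomial (ediv q γ) 1 else 0)

theorem fcoord_monomial (q : ℕ) (α : Fin n → Fin q) (γ : Fin n →₀ ℕ) (c : κ) :
    fcoord q α (monomial γ c) =
      if (∀ i, emod q γ i = α i) then monomial (ediv q γ) c else 0 := by
  have h1 : (monomial γ c : MvPolynomial (Fin n) κ) = c • (basisMonomials (Fin n) κ γ) := by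
    simp [smul_monomial]
  rw [h1, map_smul, fcoord, Module.Basis.constr_basis]
  split_ifs <;> simp [smul_monomial]

theorem fcoord_expand_mul (q : ℕ) (hq : 0 < q) (α : Fin n → Fin q)
    (a F : MvPolynomial (Fin n) κ) :
    fcoord q α (expand q a * F) = a * fcoord q α F := by
  induction a using MvPolynomial.induction_on' with
  | add p r hp hr => rw [map_add, add_mul, map_add, hp, hr, add_mul]
  | monomial u a =>
    induction F using MvPolynomial.induction_on' with
    | add p r hp hr => rw [mul_add, map_add, hp, hr, map_add, mul_add]
    | monomial v b =>
      rw [expand_monomial, monomial_mul, fcoord_monomial, fcoord_monomial]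
      have h1 : emod q (q • u + v) = emod q v := by
        ext i; simp [emod]
      have h2 : ediv q (q • u + v) = u + ediv q v := by
        ext i; simp [ediv, Nat.mul_add_div hq]
      rw [h1, h2]
      split_ifs <;> simp [monomial_mul]

theorem fcoord_sum (q : ℕ) (hq : 0 < q) (F : MvPolynomial (Fin n) κ) :
    F = ∑ α : Fin n → Fin q, expand q (fcoord q α F) *
      monomial (Finsupp.equivFunOnFinite.symm (fun i => (α i : ℕ))) 1 := by
  induction F using MvPolynomial.induction_on' with
  | add p r hp hr =>
    conv_lhs => rw [hp, hr]
    rw [← Finset.sum_add_distrib]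
    refine Finset.sum_congr rfl fun α _ => ?_
    rw [map_add, map_add, add_mul]
  | monomial u a =>
    rw [Finset.sum_eq_single (fun i => (⟨u i % q, Nat.mod_lt _ hq⟩ : Fin q))]
    · rw [fcoord_monomial, if_pos (by intro i; simp [emod]), expand_monomial, monomial_mul, mul_one]
      refine congrArg (fun v => monomial v a) ?_
      ext i
      simp [ediv, Nat.div_add_mod]
    · intro α _ hα
      rw [fcoord_monomial, if_neg, map_zero, zero_mul]
      intro h
      apply hα
      ext i
      simpa [emod] using (h i).symm
    · simp

theorem fcoord_mem (q : ℕ) (hq : 0 < q) (α : Fin n → Fin q) (J : Ideal (MvPolynomial (Fin n) κ))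
    (F : MvPolynomial (Fin n) κ) (hF : F ∈ J.map (expand q : _ →ₐ[κ] _)) :
    fcoord q α F ∈ J := by
  suffices H : ∀ a, fcoord q α (a * F) ∈ J by simpa using H 1
  induction hF using Submodule.span_induction with
  | mem x hx =>
    intro a
    obtain ⟨y, hy, rfl⟩ := hx
    have := fcoord_expand_mul q hq α y a
    rw [mul_comm] at this
    erw [this]
    exact J.mul_mem_right _ hy
  | zero => simp
  | add x y _ _ hx hy => intro a; rw [mul_add, map_add]; exact J.add_mem (hx a) (hy a)
  | smul b x _ hx => intro a; rw [smul_eq_mul, ← mul_assoc]; exact hx _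

theorem mem_map_expand_iff (q : ℕ) (hq : 0 < q) (J : Ideal (MvPolynomial (Fin n) κ))
    (F : MvPolynomial (Fin n) κ) :
    F ∈ J.map (expand q : _ →ₐ[κ] _) ↔ ∀ α, fcoord q α F ∈ J := by
  refine ⟨fun h α => fcoord_mem q hq α J F h, fun h => ?_⟩
  rw [fcoord_sum q hq F]
  exact Ideal.sum_mem _ fun α _ => Ideal.mul_mem_right _ _ (Ideal.mem_map_of_mem _ (h α))

theorem expand_mem (q : ℕ) (hq : 0 < q) (J : Ideal (MvPolynomial (Fin n) κ))
    (x : MvPolynomial (Fin n) κ) (h : expand q x ∈ J.map (expand q : _ →ₐ[κ] _)) : x ∈ J := by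
  have h0 := fcoord_mem q hq (fun _ => ⟨0, hq⟩) J _ h
  have h1 := fcoord_expand_mul q hq (fun _ => ⟨0, hq⟩) x 1
  rw [mul_one] at h1
  rw [h1] at h0
  have h2 : fcoord q (fun _ => ⟨0, hq⟩) (1 : MvPolynomial (Fin n) κ) = 1 := by
    have : (1 : MvPolynomial (Fin n) κ) = monomial 0 1 := rfl
    rw [this, fcoord_monomial, if_pos (by intro i; simp [emod])]
    congr 1
    ext i; simp [ediv]
  rwa [h2, mul_one] at h0

theorem expand_nzd (q : ℕ) (hq : 0 < q) (I : Ideal (MvPolynomial (Fin n) κ))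
    (w : MvPolynomial (Fin n) κ) (hw : ∀ x, w * x ∈ I → x ∈ I)
    (F : MvPolynomial (Fin n) κ) (h : expand q w * F ∈ I.map (expand q : _ →ₐ[κ] _)) :
    F ∈ I.map (expand q : _ →ₐ[κ] _) := by
  rw [mem_map_expand_iff q hq] at h ⊢
  intro α
  have := h α
  rw [fcoord_expand_mul q hq] at this
  exact hw _ this

theorem expand_card_pow [Fintype κ] (e : ℕ) (F : MvPolynomial (Fin n) κ) :
    expand (Fintype.card κ ^ e) F = F ^ (Fintype.card κ ^ e) := by
  obtain ⟨p, hp⟩ := CharP.exists κ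
  obtain ⟨⟨s, hs⟩, hpp, hcard⟩ := FiniteField.card κ p
  have := Fact.mk hpp
  have hq : Fintype.card κ ^ e = p ^ (s * e) := by rw [hcard, pow_mul]; rfl
  induction F using MvPolynomial.induction_on with
  | C a => rw [expand_C, ← C_pow, FiniteField.pow_card_pow]
  | add a b ha hb => rw [map_add, ha, hb, hq, add_pow_char_pow]
  | mul_X a i ha => rw [map_mul, ha, expand_X, mul_pow]

end frob

theorem span_pow_pigeonhole {R : Type*} [CommRing R] {h : ℕ} (g : Fin h → R) (q : ℕ) :
    Ideal.span (Set.range g) ^ (h * q + 1) ≤ Ideal.span (Set.range fun l => g l ^ q) := by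
  have key : ∀ s : Finset (Fin h), (Ideal.span (g '' s)) ^ (s.card * q + 1) ≤
      Ideal.span (Set.range fun l => g l ^ q) := by
    intro s
    induction s using Finset.induction_on with
    | empty => simp
    | insert a s ha ih =>
      rw [Finset.card_insert_of_notMem ha, Finset.coe_insert, Set.image_insert_eq,
        Ideal.span_insert]
      have : (s.card + 1) * q + 1 = q + (s.card * q + 1) := by ring
      rw [this]
      refine Ideal.sup_pow_add_le_pow_sup_pow.trans (sup_le ?_ ih)
      rw [Ideal.span_singleton_pow, Ideal.span_singleton_le_iff_mem]
      exact Ideal.subset_span ⟨a, rfl⟩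
  simpa using key Finset.univ

theorem finite_field_case {κ : Type*} [Field κ] [Finite κ] {n : ℕ}
    (I : Ideal (MvPolynomial (Fin n) κ)) (w f : MvPolynomial (Fin n) κ) (h m r : ℕ)
    (hr : 0 < r) (hm : h * r < m) (hw : ∀ x, w * x ∈ I → x ∈ I)
    (hwT : w ∈ tIdeal h I) (hwf : w * f ∈ I ^ m) : f ∈ I ^ r := by
  have := Fintype.ofFinite κ
  obtain ⟨e, he⟩ : ∃ e : ℕ, r * (h * r + 1) ≤ Fintype.card κ ^ e :=
    ⟨_, (Nat.lt_pow_self Fintype.one_lt_card).le⟩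
  have hexp := expand_card_pow (κ := κ) (n := n) e
  set q := Fintype.card κ ^ e with hqdef
  have hq : 0 < q := pow_pos Fintype.card_pos e
  set Iq := I.map (expand q : _ →ₐ[κ] MvPolynomial (Fin n) κ) with hIq
  have hpow : ∀ x ∈ I, x ^ q ∈ Iq := fun x hx => by
    rw [← hexp]; exact Ideal.mem_map_of_mem _ hx
  have hw1 : ∀ F, w * F ∈ Iq → F ∈ Iq := by
    intro F hF
    apply expand_nzd q hq I w hw F
    have h1 : w ^ q = w ^ (q - 1) * w := by rw [← pow_succ, Nat.sub_add_cancel hq]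
    rw [hexp, h1, mul_assoc]
    exact Ideal.mul_mem_left _ _ hF
  have hw2 : ∀ M F, w ^ M * F ∈ Iq → F ∈ Iq := by
    intro M
    induction M with
    | zero => intro F hF; simpa using hF
    | succ M ih =>
      intro F hF
      rw [pow_succ, mul_assoc] at hF
      exact hw1 _ (ih _ hF)
  have hT : tIdeal h I ≤ (Iq.colon ((I ^ (h * q + 1) : Ideal _) : Set (MvPolynomial (Fin n) κ))).radical := by
    rw [tIdeal, Ideal.span_le]
    rintro t ⟨g, hg, ht⟩
    refine ⟨h * q + 1, ?_⟩
    rw [Submodule.mem_colon]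
    intro x hx
    have h1 : Ideal.span {t} * I ≤ Ideal.span (Set.range g) := by
      rw [Ideal.span_singleton_mul_le_iff]; exact ht
    have h2 := (Ideal.pow_right_mono h1 (h * q + 1)).trans (span_pow_pigeonhole g q)
    have h3 : Ideal.span (Set.range fun l => g l ^ q) ≤ Iq := by
      rw [Ideal.span_le]
      rintro _ ⟨l, rfl⟩
      exact hpow _ (hg l)
    apply h3
    apply h2
    rw [mul_pow, Ideal.span_singleton_pow, smul_eq_mul]
    exact Ideal.mul_mem_mul (Ideal.mem_span_singleton_self _) hx
  obtain ⟨M, hM⟩ := hT hwT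
  rw [Submodule.mem_colon] at hM
  set a := q / r with ha
  have ha1 : r * a + q % r = q := Nat.div_add_mod q r
  have ha2 : q % r < r := Nat.mod_lt _ hr
  have ha3 : h * r + 1 ≤ a := by
    rw [ha, Nat.le_div_iff_mul_le hr]; linarith
  have hma : h * q + 1 ≤ m * a := by
    have e1 : (h * r + 1) * a ≤ m * a := Nat.mul_le_mul_right _ hm
    have e2 : h * q ≤ h * (r * a + r) := Nat.mul_le_mul_left _ (by omega)
    nlinarith
  have hfa : f ^ a ∈ Iq := by
    apply hw2 (M + a)
    rw [pow_add, mul_assoc, ← mul_pow]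
    have : (w * f) ^ a ∈ I ^ (h * q + 1) := by
      apply Ideal.pow_le_pow_right hma
      rw [pow_mul]
      exact Ideal.pow_mem_pow hwf a
    exact hM _ this
  apply expand_mem q hq
  have h1 : f ^ q = (f ^ a) ^ r * f ^ (q % r) := by
    rw [← pow_mul, ← pow_add, mul_comm a r, ha1]
  rw [Ideal.map_pow, hexp, h1]
  apply Ideal.mul_mem_right
  exact Ideal.pow_mem_pow hfa r

theorem exists_fin_of_finset {R : Type*} [Zero R] (T : Finset R) (h : ℕ) (hT : T.card ≤ h) :
    ∃ g : Fin h → R, (∀ l, g l ∈ T ∨ g l = 0) ∧ ∀ x ∈ T, x ∈ Set.range g := by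
  refine ⟨fun l => if hl : l.1 < T.card then (T.equivFin.symm ⟨l, hl⟩ : R) else 0, ?_, ?_⟩
  · intro l
    by_cases hl : l.1 < T.card
    · left; simp [hl]
    · right; simp [hl]
  · intro x hx
    refine ⟨⟨T.equivFin ⟨x, hx⟩, (T.equivFin ⟨x, hx⟩).2.trans_le hT⟩, ?_⟩
    simp

theorem tIdeal_not_le {R : Type*} [CommRing R] [IsRegularRing R] (I : Ideal R)
    (hrad : I.radical = I) (q : Ideal R) (hq : q ∈ I.minimalPrimes) (h : ℕ)
    (hh : q.height ≤ h) : ¬ tIdeal h I ≤ q := by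
  have hqp : q.IsPrime := hq.1.1
  have hreg := IsRegularRing.isRegularLocalRing_localization q
  let L := Localization.AtPrime q
  have hmax : IsLocalRing.maximalIdeal L = I.map (algebraMap R L) := by
    rw [← Localization.AtPrime.map_eq_maximalIdeal]
    apply le_antisymm _ (Ideal.map_mono hq.1.2)
    rw [Ideal.map_le_iff_le_comap]
    intro x hx
    have h1 := Ideal.mem_map_of_mem (algebraMap R L) hx
    rw [← IsLocalization.AtPrime.radical_map_of_mem_minimalPrimes L q I hq] at h1
    obtain ⟨n, hn⟩ := h1
    rw [← map_pow, IsLocalization.algebraMap_mem_map_algebraMap_iff q.primeCompl] at hn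
    obtain ⟨t, ht, htx⟩ := hn
    rw [Ideal.mem_comap, IsLocalization.algebraMap_mem_map_algebraMap_iff q.primeCompl]
    refine ⟨t, ht, ?_⟩
    rw [← hrad]
    refine ⟨n + 1, ?_⟩
    have : (t * x) ^ (n + 1) = (t ^ n * x) * (t * x ^ n) := by ring
    rw [this]
    exact Ideal.mul_mem_left _ _ htx
  have hfg : (IsLocalRing.maximalIdeal L).FG := IsNoetherian.noetherian _
  have hrank : (IsLocalRing.maximalIdeal L).spanFinrank ≤ h := by
    have h1 := hreg.spanFinrank_maximalIdeal
    rw [IsLocalization.AtPrime.ringKrullDim_eq_height q] at h1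
    have h2 : (((IsLocalRing.maximalIdeal L).spanFinrank : ℕ∞) : WithBot ℕ∞) = q.height := h1
    have h3 := WithBot.coe_injective h2
    rw [← h3] at hh
    exact_mod_cast hh
  obtain ⟨s, hcard, hs⟩ := Submodule.FG.exists_span_finset_card_eq_spanFinrank hfg
  have hlift : ∀ y ∈ IsLocalRing.maximalIdeal L, ∃ x ∈ I, y ∈ Ideal.span {algebraMap R L x} := by
    intro y hy
    rw [hmax, IsLocalization.mem_map_algebraMap_iff q.primeCompl] at hy
    obtain ⟨⟨⟨x, hx⟩, u⟩, hxu⟩ := hy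
    refine ⟨x, hx, ?_⟩
    simp only at hxu
    rw [Ideal.mem_span_singleton, ← hxu]
    exact (IsLocalization.map_units L u).mul_right_dvd.mpr dvd_rfl
  choose! lf hlf1 hlf2 using hlift
  have hsmem : ∀ y ∈ s, y ∈ IsLocalRing.maximalIdeal L := fun y hy => by
    rw [← hs]; exact Submodule.subset_span hy
  classical
  obtain ⟨g, hg1, hg2⟩ := exists_fin_of_finset (s.image lf) h
    (Finset.card_image_le.trans (hcard.le.trans hrank))
  have hgI : ∀ l, g l ∈ I := by
    intro l
    rcases hg1 l with h1 | h1
    · obtain ⟨y, hy, hy2⟩ := Finset.mem_image.mp h1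
      rw [← hy2]
      exact hlf1 y (hsmem y hy)
    · rw [h1]; exact I.zero_mem
  have hmaxle : IsLocalRing.maximalIdeal L ≤ (Ideal.span (Set.range g)).map (algebraMap R L) := by
    rw [← hs]
    refine Ideal.span_le.mpr ?_
    intro y hy
    have h1 := hlf2 y (hsmem y hy)
    refine (Ideal.span_singleton_le_iff_mem _).mpr ?_ h1
    apply Ideal.mem_map_of_mem
    exact Ideal.subset_span (hg2 _ (Finset.mem_image_of_mem lf hy))
  have hpt : ∀ x ∈ I, ∃ t, t ∉ q ∧ t * x ∈ Ideal.span (Set.range g) := by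
    intro x hx
    have h1 : algebraMap R L x ∈ (Ideal.span (Set.range g)).map (algebraMap R L) := by
      apply hmaxle
      rw [hmax]
      exact Ideal.mem_map_of_mem _ hx
    rw [IsLocalization.algebraMap_mem_map_algebraMap_iff q.primeCompl] at h1
    exact h1
  have huni : ∀ S : Finset R, (∀ x ∈ S, x ∈ I) →
      ∃ t, t ∉ q ∧ ∀ x ∈ S, t * x ∈ Ideal.span (Set.range g) := by
    intro S
    induction S using Finset.induction_on with
    | empty => intro _; exact ⟨1, fun h1 => hqp.ne_top ((Ideal.eq_top_iff_one q).2 h1), by simp⟩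
    | insert a S ha ih =>
      intro hS
      obtain ⟨t, ht, htS⟩ := ih fun x hx => hS x (Finset.mem_insert_of_mem hx)
      obtain ⟨u, hu, hua⟩ := hpt a (hS a (Finset.mem_insert_self _ _))
      refine ⟨t * u, fun h1 => (hqp.mem_or_mem h1).elim ht hu, ?_⟩
      intro x hx
      rcases Finset.mem_insert.mp hx with rfl | hx
      · rw [mul_assoc]; exact Ideal.mul_mem_left _ _ hua
      · rw [mul_comm t, mul_assoc]; exact Ideal.mul_mem_left _ _ (htS x hx)
  obtain ⟨S, hS⟩ := (IsNoetherian.noetherian I : I.FG)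
  obtain ⟨t, ht, htS⟩ := huni S (fun x hx => by rw [← hS]; exact Submodule.subset_span hx)
  intro hle
  apply ht
  apply hle
  refine Ideal.subset_span ⟨g, hgI, ?_⟩
  intro x hx
  have h1 : Ideal.span {t} * I ≤ Ideal.span (Set.range g) := by
    rw [← hS]
    change Ideal.span {t} * Ideal.span (S : Set R) ≤ _
    rw [Ideal.span_mul_span', Ideal.span_le]
    rintro _ ⟨a, rfl, b, hb, rfl⟩
    exact htS b hb
  exact h1 (Ideal.mul_mem_mul (Ideal.mem_span_singleton_self t) hx)

theorem exists_nzd {R : Type*} [CommRing R] [IsNoetherianRing R] (I : Ideal R)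
    (hrad : I.radical = I) (J : Ideal R) (hJ : ∀ q ∈ I.minimalPrimes, ¬ J ≤ q) :
    ∃ w ∈ J, ∀ x, w * x ∈ I → x ∈ I := by
  have hfin := Ideal.finite_minimalPrimes_of_isNoetherianRing R I
  have hnot : ¬ ((J : Set R) ⊆ ⋃ i ∈ (↑hfin.toFinset : Set (Ideal R)), ((i : Ideal R) : Set R)) := by
    rw [Ideal.subset_union_prime (f := fun i : Ideal R => i) ⊤ ⊤
      (fun i hi _ _ => (hfin.mem_toFinset.mp hi).1.1)]
    rintro ⟨i, hi, hle⟩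
    exact hJ i (hfin.mem_toFinset.mp hi) hle
  rw [Set.not_subset] at hnot
  obtain ⟨w, hw, hwn⟩ := hnot
  refine ⟨w, hw, fun x hx => ?_⟩
  rw [← hrad, ← Ideal.sInf_minimalPrimes, Ideal.mem_sInf]
  intro q hq
  refine (hq.1.1.mem_or_mem (hq.1.2 hx)).resolve_left fun h1 => hwn ?_
  simp only [Set.mem_iUnion]
  exact ⟨q, by simpa using hq, h1⟩

section reduction
open Filter
variable {k : Type*} [Field k] {n : ℕ}

/-- The subring of `k` generated by a finite set. -/
noncomputable abbrev AA (C : Finset k) : Subalgebra ℤ k := Algebra.adjoin ℤ (C : Set k)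

/-- The inclusion of polynomials with coefficients in `AA C`. -/
noncomputable abbrev iot (n : ℕ) (C : Finset k) :
    MvPolynomial (Fin n) (AA C) →+* MvPolynomial (Fin n) k :=
  MvPolynomial.map (algebraMap (AA C) k)

theorem algMap_inj (C : Finset k) : Function.Injective (algebraMap (AA C) k) :=
  Subtype.val_injective

theorem iot_inj (C : Finset k) : Function.Injective (iot n C) :=
  MvPolynomial.map_injective _ (algMap_inj C)

theorem ev_mem (c : k) : ∀ᶠ C : Finset k in atTop, c ∈ AA C := by
  filter_upwards [eventually_ge_atTop {c}] with C hC
  exact Algebra.subset_adjoin (by simpa using hC)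

theorem ev_lift (x : MvPolynomial (Fin n) k) :
    ∀ᶠ C : Finset k in atTop, ∃ y, iot n C y = x := by
  induction x using MvPolynomial.induction_on with
  | C a =>
    filter_upwards [ev_mem a] with B hB
    exact ⟨C ⟨a, hB⟩, by rw [map_C]; rfl⟩
  | add p q hp hq =>
    filter_upwards [hp, hq] with B ⟨y, hy⟩ ⟨z, hz⟩
    exact ⟨y + z, by rw [map_add, hy, hz]⟩
  | mul_X p i hp =>
    filter_upwards [hp] with B ⟨y, hy⟩
    exact ⟨y * X i, by rw [map_mul, hy, map_X]⟩

theorem exists_groebner (J : Ideal (MvPolynomial (Fin n) k)) :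
    ∃ (B : Set (Fin n →₀ ℕ)) (G : Finset (MvPolynomial (Fin n) k)),
      (∀ g ∈ G, g ∈ J) ∧ (∀ R ∈ J, (∀ c ∈ R.support, c ∈ B) → R = 0) ∧
      ∀ᶠ C : Finset k in atTop, ∀ F : MvPolynomial (Fin n) (AA C),
        ∃ R, (∀ c ∈ R.support, c ∈ B) ∧ F - R ∈ Ideal.span (iot n C ⁻¹' G) := by
  classical
  let m : MonomialOrder (Fin n) := MonomialOrder.lex
  let D : (Fin n →₀ ℕ) → Prop := fun d => ∃ F ∈ J, F ≠ 0 ∧ m.degree F = d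
  have hfin : {d | Minimal D d}.Finite :=
    ((wellQuasiOrderedLE_iff (α := Fin n →₀ ℕ)).mp inferInstance).2 _ (setOfPred_minimal_antichain D)
  have hmonic : ∀ d, D d → ∃ g ∈ J, m.degree g = d ∧ g.coeff d = 1 := by
    rintro d ⟨F, hF, hF0, rfl⟩
    have hlc : m.leadingCoeff F ≠ 0 := m.leadingCoeff_ne_zero_iff.mpr hF0
    refine ⟨(m.leadingCoeff F)⁻¹ • F, ?_, ?_, ?_⟩
    · rw [smul_eq_C_mul]; exact J.mul_mem_left _ hF
    · exact m.degree_smul_of_isRegular (IsRegular.of_ne_zero (inv_ne_zero hlc))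
    · rw [coeff_smul, smul_eq_mul]; exact inv_mul_cancel₀ hlc
  choose! gf hgJ hgd hgc using hmonic
  let G : Finset (MvPolynomial (Fin n) k) := hfin.toFinset.image gf
  have hG : ∀ g ∈ G, g ∈ J ∧ g.coeff (m.degree g) = 1 := by
    intro g hg
    obtain ⟨d, hd, rfl⟩ := Finset.mem_image.mp hg
    have hd' : D d := (hfin.mem_toFinset.mp hd).1
    refine ⟨hgJ d hd', ?_⟩
    rw [hgd d hd']; exact hgc d hd'
  refine ⟨{c | ∀ g ∈ G, ¬ m.degree g ≤ c}, G, fun g hg => (hG g hg).1, ?_, ?_⟩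
  · intro R hR hRB
    by_contra hR0
    obtain ⟨d, hdle, hd⟩ := exists_minimal_le_of_wellFoundedLT D (m.degree R) ⟨R, hR, hR0, rfl⟩
    refine hRB _ (m.degree_mem_support hR0) (gf d)
      (Finset.mem_image_of_mem _ (hfin.mem_toFinset.mpr hd)) ?_
    rwa [hgd d hd.1]
  · have hl : ∀ᶠ C : Finset k in atTop, ∀ g ∈ G, ∃ y, iot n C y = g :=
      (eventually_all_finset G).mpr fun g _ => ev_lift g
    filter_upwards [hl] with C hC F
    have hdeg : ∀ b : MvPolynomial (Fin n) (AA C), m.degree (iot n C b) = m.degree b := by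
      intro b
      unfold MonomialOrder.degree
      rw [MvPolynomial.support_map_of_injective _ (algMap_inj C)]
    obtain ⟨g, R, hFR, -, hR⟩ := m.div_set (B := iot n C ⁻¹' G) (by
      intro b hb
      have h1 := (hG _ hb).2
      rw [hdeg, MvPolynomial.coeff_map] at h1
      have h2 : m.leadingCoeff b = 1 := algMap_inj C (by rw [map_one]; exact h1)
      rw [h2]; exact isUnit_one) F
    refine ⟨R, ?_, ?_⟩
    · intro c hc g hg hle
      obtain ⟨y, rfl⟩ := hC g hg
      rw [hdeg] at hle
      exact hR c hc y hg hle
    · rw [hFR, add_sub_cancel_right]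
      rw [Finsupp.linearCombination_apply]
      refine Ideal.sum_mem _ fun b _ => ?_
      exact Ideal.mul_mem_left _ _ (Ideal.subset_span b.2)

/-- Contraction of an ideal to `AA C`. -/
noncomputable abbrev ctr (J : Ideal (MvPolynomial (Fin n) k)) (C : Finset k) :
    Ideal (MvPolynomial (Fin n) (AA C)) := J.comap (iot n C)

theorem ev_ctr_span (J : Ideal (MvPolynomial (Fin n) k)) :
    ∃ G : Finset (MvPolynomial (Fin n) k), (∀ g ∈ G, g ∈ J) ∧
      ∀ᶠ C : Finset k in atTop, ctr J C = Ideal.span (iot n C ⁻¹' G) := by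
  obtain ⟨B, G, hGJ, hB, hev⟩ := exists_groebner J
  refine ⟨G, hGJ, ?_⟩
  filter_upwards [hev] with C hC
  have hle : Ideal.span (iot n C ⁻¹' G) ≤ ctr J C := by
    rw [Ideal.span_le]
    intro b hb
    exact hGJ _ hb
  refine le_antisymm ?_ hle
  intro F hF
  obtain ⟨R, hRB, hR⟩ := hC F
  have h1 : R ∈ ctr J C := by
    have := (ctr J C).sub_mem hF (hle hR)
    simpa using this
  have h2 : iot n C R = 0 := hB _ h1 (by
    intro c hc; exact hRB c (MvPolynomial.support_map_subset _ _ hc))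
  have h3 : R = 0 := iot_inj C (by rw [h2, map_zero])
  simpa [h3] using hR

theorem ev_complement (J : Ideal (MvPolynomial (Fin n) k)) :
    ∃ (B : Set (Fin n →₀ ℕ)), (∀ R ∈ J, (∀ c ∈ R.support, c ∈ B) → R = 0) ∧
      (∀ F : MvPolynomial (Fin n) k, ∃ R, (∀ c ∈ R.support, c ∈ B) ∧ F - R ∈ J) ∧
      ∀ᶠ A : Finset k in atTop, ∀ μ : Ideal (AA A),
        ∀ F ∈ μ.map (C : AA A →+* MvPolynomial (Fin n) (AA A)),
        ∃ R ∈ μ.map (C : AA A →+* MvPolynomial (Fin n) (AA A)), (∀ c ∈ R.support, c ∈ B) ∧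
          F - R ∈ μ.map (C : AA A →+* MvPolynomial (Fin n) (AA A)) * ctr J A := by
  classical
  obtain ⟨B, G, hGJ, hB, hev⟩ := exists_groebner J
  have hle : ∀ A : Finset k, Ideal.span (iot n A ⁻¹' G) ≤ ctr J A := by
    intro A
    rw [Ideal.span_le]
    intro b hb
    exact hGJ _ hb
  refine ⟨B, hB, ?_, ?_⟩
  · intro F
    obtain ⟨A, ⟨y, rfl⟩, hA⟩ := ((ev_lift F).and hev).exists
    obtain ⟨R, hRB, hR⟩ := hA y
    refine ⟨iot n A R, fun c hc => hRB c (MvPolynomial.support_map_subset _ _ hc), ?_⟩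
    rw [← map_sub]
    exact hle A hR
  · filter_upwards [hev] with A hA μ F hF
    suffices H : ∀ a, ∃ R ∈ μ.map (C : AA A →+* MvPolynomial (Fin n) (AA A)),
        (∀ c ∈ R.support, c ∈ B) ∧
          a * F - R ∈ μ.map (C : AA A →+* MvPolynomial (Fin n) (AA A)) * ctr J A by
      simpa using H 1
    induction hF using Submodule.span_induction with
    | mem x hx =>
      intro a
      obtain ⟨c, hc, rfl⟩ := hx
      obtain ⟨R, hRB, hR⟩ := hA a
      have hcm : C c ∈ μ.map (C : AA A →+* MvPolynomial (Fin n) (AA A)) :=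
        Ideal.mem_map_of_mem _ hc
      refine ⟨C c * R, Ideal.mul_mem_right _ _ hcm, ?_, ?_⟩
      · intro d hd
        apply hRB
        rw [MvPolynomial.mem_support_iff, MvPolynomial.coeff_C_mul] at hd
        rw [MvPolynomial.mem_support_iff]
        exact right_ne_zero_of_mul hd
      · have : a * C c - C c * R = C c * (a - R) := by ring
        rw [this]
        exact Ideal.mul_mem_mul hcm (hle A hR)
    | zero => intro a; exact ⟨0, Ideal.zero_mem _, by simp, by simp⟩
    | add x y _ _ hx hy =>
      intro a
      obtain ⟨R, h1, h2, h3⟩ := hx a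
      obtain ⟨R', h1', h2', h3'⟩ := hy a
      refine ⟨R + R', Ideal.add_mem _ h1 h1', ?_, ?_⟩
      · intro c hc
        rcases Finset.mem_union.mp (MvPolynomial.support_add hc) with h | h
        · exact h2 c h
        · exact h2' c h
      · have : a * (x + y) - (R + R') = (a * x - R) + (a * y - R') := by ring
        rw [this]; exact Ideal.add_mem _ h3 h3'
    | smul b x _ hx =>
      intro a
      rw [smul_eq_mul, ← mul_assoc]
      exact hx _

set_option maxHeartbeats 1000000 in
theorem ev_not_mem (J : Ideal (MvPolynomial (Fin n) k)) (f : MvPolynomial (Fin n) k)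
    (hf : f ∉ J) :
    ∀ᶠ A : Finset k in atTop, ∀ μ : Ideal (AA A), μ ≠ ⊤ → ∀ f', iot n A f' = f →
      f' ∉ ctr J A ⊔ μ.map (C : AA A →+* MvPolynomial (Fin n) (AA A)) := by
  classical
  obtain ⟨B, hB, hdiv, hev⟩ := ev_complement J
  obtain ⟨R, hRB, hR⟩ := hdiv f
  have hR0 : R ≠ 0 := by
    rintro rfl
    exact hf (by simpa using hR)
  obtain ⟨c, hc⟩ := MvPolynomial.ne_zero_iff.mp hR0
  filter_upwards [hev, ev_lift R, ev_mem (R.coeff c)⁻¹] with A hA ⟨R', hR'⟩ hinv μ hμ f' hf' hmem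
  obtain ⟨j, hj, E, hE, hjE⟩ := Submodule.mem_sup.mp hmem
  obtain ⟨S, hS, hSB, hES⟩ := hA μ E hE
  have hml : μ.map (C : AA A →+* MvPolynomial (Fin n) (AA A)) * ctr J A ≤ ctr J A :=
    Ideal.mul_le_right
  have hES' : E - S ∈ ctr J A := hml hES
  have h1 : R' - f' ∈ ctr J A := by
    rw [Ideal.mem_comap, map_sub, hR', hf', ← neg_sub]
    exact J.neg_mem hR
  have h2 : R' - S ∈ ctr J A := by
    have : R' - S = (R' - f') + j + (E - S) := by rw [← hjE]; ring
    rw [this]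
    exact Ideal.add_mem _ (Ideal.add_mem _ h1 hj) hES'
  have h3 : iot n A (R' - S) = 0 := hB _ h2 (by
    intro d hd
    have hd1 := MvPolynomial.support_map_subset _ _ hd
    rcases Finset.mem_union.mp (MvPolynomial.support_sub _ _ _ hd1) with h | h
    · apply hRB
      rw [← hR']
      rwa [MvPolynomial.support_map_of_injective _ (algMap_inj A)]
    · exact hSB d h)
  have h4 : R' = S := sub_eq_zero.mp (iot_inj A (by rw [h3, map_zero]))
  rw [← h4] at hS
  have h5 := MvPolynomial.mem_map_C_iff.mp hS c
  apply hμ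
  rw [Ideal.eq_top_iff_one]
  have h6 : (1 : AA A) = ⟨_, hinv⟩ * R'.coeff c := by
    apply algMap_inj A
    rw [map_mul, ← MvPolynomial.coeff_map, map_one]
    change 1 = (R.coeff c)⁻¹ * (iot n A R').coeff c
    rw [hR', inv_mul_cancel₀ hc]
  rw [h6]
  exact Ideal.mul_mem_left _ _ h5

set_option maxHeartbeats 1000000 in
theorem ev_nzd (I : Ideal (MvPolynomial (Fin n) k)) (w : MvPolynomial (Fin n) k)
    (hw : ∀ x, w * x ∈ I → x ∈ I) :
    ∀ᶠ A : Finset k in atTop, ∀ μ : Ideal (AA A), ∀ w', iot n A w' = w → ∀ x,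
      w' * x ∈ ctr I A ⊔ μ.map (C : AA A →+* MvPolynomial (Fin n) (AA A)) →
      x ∈ ctr I A ⊔ μ.map (C : AA A →+* MvPolynomial (Fin n) (AA A)) := by
  classical
  obtain ⟨B, hB, -, hev⟩ := ev_complement (I ⊔ Ideal.span {w})
  obtain ⟨G, hGL, hG⟩ := ev_ctr_span (I ⊔ Ideal.span {w})
  have hGu : ∀ g ∈ G, ∃ u, g - w * u ∈ I := by
    intro g hg
    obtain ⟨i, hi, v, hv, hiv⟩ := Submodule.mem_sup.mp (hGL g hg)
    obtain ⟨u, rfl⟩ := Ideal.mem_span_singleton.mp hv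
    exact ⟨u, by rw [← hiv]; simpa using hi⟩
  choose! u hu using hGu
  have hul : ∀ᶠ A : Finset k in atTop, ∀ g ∈ G, ∃ y, iot n A y = u g :=
    (eventually_all_finset G).mpr fun g _ => ev_lift (u g)
  filter_upwards [hev, hG, hul] with A hA hGA huA μ w' hw' x hx
  have hL : ctr (I ⊔ Ideal.span {w}) A ≤ ctr I A ⊔ Ideal.span {w'} := by
    rw [hGA, Ideal.span_le]
    intro b hb
    obtain ⟨y, hy⟩ := huA _ hb
    refine Submodule.mem_sup.mpr ⟨b - w' * y, ?_, w' * y,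
      Ideal.mul_mem_right _ _ (Ideal.mem_span_singleton_self _), by ring⟩
    rw [Ideal.mem_comap, map_sub, map_mul, hw', hy]
    exact hu _ hb
  obtain ⟨i, hi, E, hE, hiE⟩ := Submodule.mem_sup.mp hx
  have hEL : E ∈ ctr (I ⊔ Ideal.span {w}) A := by
    have h1 : E = w' * x - i := by rw [← hiE]; ring
    rw [h1, Ideal.mem_comap, map_sub, map_mul, hw']
    refine Ideal.sub_mem _ (Ideal.mul_mem_right _ _ ?_) (Ideal.mem_sup_left hi)
    exact Ideal.mem_sup_right (Ideal.mem_span_singleton_self _)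
  obtain ⟨S, hS, hSB, hES⟩ := hA μ E hE
  have hSL : S ∈ ctr (I ⊔ Ideal.span {w}) A := by
    have hml : μ.map (C : AA A →+* MvPolynomial (Fin n) (AA A)) *
        ctr (I ⊔ Ideal.span {w}) A ≤ ctr (I ⊔ Ideal.span {w}) A := Ideal.mul_le_right
    have h0 := (ctr (I ⊔ Ideal.span {w}) A).sub_mem hEL (hml hES)
    rwa [sub_sub_cancel] at h0
  have h3 : iot n A S = 0 := hB _ hSL (by
    intro d hd
    exact hSB d (MvPolynomial.support_map_subset _ _ hd))
  have h4 : S = 0 := iot_inj A (by rw [h3, map_zero])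
  rw [h4, sub_zero] at hES
  have h5 := Ideal.mul_mono_right hL hES
  rw [Ideal.mul_sup] at h5
  obtain ⟨i', hi', v, hv, hiv⟩ := Submodule.mem_sup.mp h5
  rw [mul_comm, Ideal.mem_span_singleton_mul] at hv
  obtain ⟨e, he, rfl⟩ := hv
  have h6 : x - e ∈ ctr I A := by
    rw [Ideal.mem_comap]
    apply hw
    rw [← hw', ← map_mul]
    have h7 : w' * (x - e) = i + i' := by
      rw [mul_sub, ← hiE, ← hiv]; ring
    rw [h7]
    have hml : μ.map (C : AA A →+* MvPolynomial (Fin n) (AA A)) * ctr I A ≤ ctr I A :=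
      Ideal.mul_le_right
    exact (ctr I A).add_mem hi (hml hi')
  exact Submodule.mem_sup.mpr ⟨x - e, h6, e, he, by ring⟩

theorem ev_pow (I : Ideal (MvPolynomial (Fin n) k)) (m : ℕ) :
    ∀ x ∈ I ^ m, ∀ᶠ A : Finset k in atTop, ∃ y ∈ ctr I A ^ m, iot n A y = x := by
  induction m with
  | zero =>
    intro x _
    filter_upwards [ev_lift x] with A ⟨y, hy⟩
    exact ⟨y, by simp, hy⟩
  | succ m ih =>
    intro x hx
    rw [pow_succ] at hx
    induction hx using Submodule.mul_induction_on' with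
    | mem_mul_mem a ha b hb =>
      filter_upwards [ih a ha, ev_lift b] with A ⟨y, hy, hya⟩ ⟨z, hz⟩
      refine ⟨y * z, ?_, by rw [map_mul, hya, hz]⟩
      rw [pow_succ]
      refine Ideal.mul_mem_mul hy ?_
      rw [Ideal.mem_comap, hz]; exact hb
    | add a _ b _ ha hb =>
      filter_upwards [ha, hb] with A ⟨y, hy, hya⟩ ⟨z, hz, hzb⟩
      exact ⟨y + z, Ideal.add_mem _ hy hz, by rw [map_add, hya, hzb]⟩

theorem ev_tIdeal (I : Ideal (MvPolynomial (Fin n) k)) (h : ℕ) :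
    ∀ x ∈ tIdeal h I, ∀ᶠ A : Finset k in atTop, ∃ y ∈ tIdeal h (ctr I A), iot n A y = x := by
  classical
  intro x hx
  induction hx using Submodule.span_induction with
  | mem t ht =>
    obtain ⟨g, hgI, hg⟩ := ht
    obtain ⟨G, hGI, hG⟩ := ev_ctr_span I
    have h1 : ∀ z ∈ G, ∃ c : Fin h → MvPolynomial (Fin n) k, ∑ l, c l * g l = t * z := by
      intro z hz
      exact Ideal.mem_span_range_iff_exists_fun.mp (hg z (hGI z hz))
    choose! c hc using h1
    have h2 : ∀ᶠ A : Finset k in atTop, ∀ z ∈ G, ∀ l, ∃ y, iot n A y = c z l :=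
      (eventually_all_finset G).mpr fun z _ => eventually_all.mpr fun l => ev_lift _
    have h3 : ∀ᶠ A : Finset k in atTop, ∀ l, ∃ y, iot n A y = g l :=
      eventually_all.mpr fun l => ev_lift _
    filter_upwards [hG, h2, h3, ev_lift t] with A hGA hcA hgA ⟨t', ht'⟩
    choose g' hg' using hgA
    refine ⟨t', Ideal.subset_span ⟨g', ?_, ?_⟩, ht'⟩
    · intro l
      rw [Ideal.mem_comap, hg']
      exact hgI l
    · intro x hx
      have h4 : Ideal.span {t'} * ctr I A ≤ Ideal.span (Set.range g') := by
        rw [hGA, Ideal.span_mul_span', Ideal.span_le]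
        rintro _ ⟨a, rfl, b, hb, rfl⟩
        choose c' hc' using hcA _ hb
        refine Ideal.mem_span_range_iff_exists_fun.mpr ⟨c', iot_inj A ?_⟩
        simp only [map_sum, map_mul, hc', hg', ht']
        exact hc _ hb
      exact h4 (Ideal.mul_mem_mul (Ideal.mem_span_singleton_self t') hx)
  | zero => exact Eventually.of_forall fun A => ⟨0, Ideal.zero_mem _, map_zero _⟩
  | add a b _ _ ha hb =>
    filter_upwards [ha, hb] with A ⟨y, hy, hya⟩ ⟨z, hz, hzb⟩
    exact ⟨y + z, Ideal.add_mem _ hy hz, by rw [map_add, hya, hzb]⟩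
  | smul a b _ hb =>
    filter_upwards [ev_lift a, hb] with A ⟨y, hya⟩ ⟨z, hz, hzb⟩
    exact ⟨y * z, Ideal.mul_mem_left _ _ hz, by rw [map_mul, hya, hzb]; rfl⟩

theorem tIdeal_map {R S : Type*} [CommRing R] [CommRing S] (φ : R →+* S)
    (hφ : Function.Surjective φ) (h : ℕ) (I : Ideal R) (w : R) (hw : w ∈ tIdeal h I) :
    φ w ∈ tIdeal h (I.map φ) := by
  suffices H : tIdeal h I ≤ (tIdeal h (I.map φ)).comap φ from H hw
  conv_lhs => rw [tIdeal]
  rw [Ideal.span_le]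
  rintro t ⟨g, hg, ht⟩
  refine Ideal.subset_span ⟨fun l => φ (g l), fun l => Ideal.mem_map_of_mem _ (hg l), ?_⟩
  intro x hx
  obtain ⟨y, hy, rfl⟩ := (Ideal.mem_map_iff_of_surjective φ hφ).mp hx
  rw [← map_mul]
  have h1 := Ideal.mem_map_of_mem φ (ht y hy)
  rw [Ideal.map_span, ← Set.range_comp] at h1
  exact h1

theorem isJacobson_int : IsJacobsonRing ℤ := by
  rw [isJacobsonRing_iff_prime_eq]
  intro P hP
  by_cases h0 : P = ⊥
  · subst h0
    refine le_antisymm ?_ bot_le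
    intro x hx
    have h1 := Ideal.mem_jacobson_bot.mp hx x
    rw [Int.isUnit_iff] at h1
    have h2 : x * x = 0 := by
      rcases h1 with h | h <;> nlinarith [mul_self_nonneg x]
    exact mul_self_eq_zero.mp h2
  · have := hP.isMaximal h0
    exact Ideal.jacobson_eq_self_of_isMaximal

theorem finite_of_int_finite (K : Type*) [Field K] [Module.Finite ℤ K] : Finite K := by
  obtain ⟨p, hp⟩ := CharP.exists K
  rcases CharP.char_is_prime_or_zero K p with h | h
  · have : Fact p.Prime := ⟨h⟩
    let := ZMod.algebra K p
    have h2 : Module.Finite (ZMod p) K := Module.Finite.of_restrictScalars_finite ℤ _ _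
    exact Module.finite_of_finite (ZMod p)
  · subst h
    have := CharP.charP_to_charZero K
    exact absurd (isField_of_isIntegral_of_isField (R := ℤ) (S := K)
      (by simpa using Int.cast_injective) (Field.toIsField K)) Int.not_isField

theorem finite_residue (A : Finset k) (μ : Ideal (AA A)) (hμ : μ.IsMaximal) :
    Finite (AA A ⧸ μ) := by
  have := isJacobson_int
  let := Ideal.Quotient.field μ
  have h1 : Algebra.FiniteType ℤ (AA A) :=
    (Subalgebra.fg_iff_finiteType _).mp (Subalgebra.fg_adjoin_finset A)
  have h2 : Algebra.FiniteType ℤ (AA A ⧸ μ) :=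
    h1.of_surjective (Ideal.Quotient.mkₐ ℤ μ) (Ideal.Quotient.mkₐ_surjective ℤ μ)
  have h3 : Module.Finite ℤ (AA A ⧸ μ) := finite_of_finite_type_of_isJacobsonRing ℤ _
  exact finite_of_int_finite _

theorem main_containment (I : Ideal (MvPolynomial (Fin n) k)) (w f : MvPolynomial (Fin n) k)
    (h m r : ℕ) (hr : 0 < r) (hm : h * r < m) (hw : ∀ x, w * x ∈ I → x ∈ I)
    (hwT : w ∈ tIdeal h I) (hwf : w * f ∈ I ^ m) : f ∈ I ^ r := by
  by_contra hf
  obtain ⟨A, h1, h2, ⟨f', hf'⟩, ⟨v, hv, hvf⟩, ⟨w', hw', hww⟩⟩ :=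
    ((ev_not_mem _ f hf).and ((ev_nzd I w hw).and ((ev_lift f).and
      ((ev_pow I m _ hwf).and (ev_tIdeal I h w hwT))))).exists
  obtain ⟨μ, hμ⟩ := Ideal.exists_maximal (AA A)
  have hfin := finite_residue A μ hμ
  let := Ideal.Quotient.field μ
  let φ : MvPolynomial (Fin n) (AA A) →+* MvPolynomial (Fin n) (AA A ⧸ μ) :=
    MvPolynomial.map (Ideal.Quotient.mk μ)
  have hφ : Function.Surjective φ := MvPolynomial.map_surjective _ Ideal.Quotient.mk_surjective
  have hker : ∀ (J : Ideal (MvPolynomial (Fin n) (AA A))) (x), φ x ∈ J.map φ ↔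
      x ∈ J ⊔ μ.map (C : AA A →+* MvPolynomial (Fin n) (AA A)) := by
    intro J x
    rw [← Ideal.mem_comap, Ideal.comap_map_of_surjective' φ hφ, MvPolynomial.ker_map,
      Ideal.mk_ker]
  have hvw : v = w' * f' := iot_inj A (by rw [map_mul, hvf, hww, hf'])
  have key : φ f' ∈ (ctr I A).map φ ^ r := by
    refine finite_field_case _ (φ w') (φ f') h m r hr hm ?_ (tIdeal_map φ hφ h _ _ hw') ?_
    · intro x hx
      obtain ⟨x, rfl⟩ := hφ x
      rw [← map_mul, hker] at hx
      rw [hker]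
      exact h2 μ w' hww x hx
    · rw [← map_mul, ← hvw, ← Ideal.map_pow]
      exact Ideal.mem_map_of_mem _ hv
  rw [← Ideal.map_pow, hker] at key
  have hpow : ctr I A ^ r ≤ ctr (I ^ r) A := by
    rw [← Ideal.map_le_iff_le_comap, Ideal.map_pow]
    exact Ideal.pow_right_mono Ideal.map_comap_le r
  have hle := sup_le_sup_right hpow (μ.map (C : AA A →+* MvPolynomial (Fin n) (AA A)))
  exact h1 μ hμ.ne_top f' hf' (hle key)

end reduction

end helpers

/-- **Bound on the resurgence.** If `h` is the largest height of a minimal prime of a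
nonzero proper radical ideal `I` of `k[X_0, …, X_d]`, then `ρ(I) ≤ h`: whenever
`I^{(m)} ⊄ I^r` for positive integers `m, r`, one has `m / r ≤ h`. -/
theorem resurgence_le_max_height (k : Type*) [Field k] (d : ℕ)
    (I : Ideal (MvPolynomial (Fin (d + 1)) k))
    (hne : I ≠ ⊥) (hproper : I ≠ ⊤) (hrad : I.radical = I)
    (h : ℕ)
    (hmax : IsGreatest {m : ℕ∞ | ∃ q ∈ I.minimalPrimes, idealHeight q = m} (h : ℕ∞)) :
    ∀ m r : ℕ, 0 < m → 0 < r → ¬ symbolicPower I m ≤ I ^ r → (m : ℝ) / r ≤ h := by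
  intro m r _ hr hnot
  by_contra hlt
  apply hnot
  have hm : h * r < m := by
    rw [not_le, lt_div_iff₀ (by exact_mod_cast hr)] at hlt
    exact_mod_cast hlt
  intro f hf
  have hht : ∀ q ∈ I.minimalPrimes, q.height ≤ h := by
    intro q hq
    refine le_trans ?_ (hmax.2 ⟨q, hq, rfl⟩)
    refine le_iInf fun p => le_iInf fun hp => ?_
    rw [← PrimeSpectrum.height_eq_orderHeight]
    exact Ideal.height_mono hp
  obtain ⟨w, hwJ, hw⟩ := exists_nzd I hrad
    (tIdeal h I ⊓ Submodule.comap (LinearMap.mulRight (MvPolynomial (Fin (d + 1)) k) f) (I ^ m)) (by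
      intro q hq hle
      have hqp : q.IsPrime := hq.1.1
      obtain ⟨t, ht, htq⟩ := SetLike.not_le_iff_exists.mp
        (tIdeal_not_le I hrad q hq h (hht q hq))
      obtain ⟨s, hs, hsf⟩ := hf q hq
      have hmem : t * s ∈ q := hle ⟨Ideal.mul_mem_right _ _ ht, by
        change t * s * f ∈ I ^ m
        rw [mul_assoc]
        exact Ideal.mul_mem_left _ _ hsf⟩
      exact (hqp.mem_or_mem hmem).elim htq hs)
  exact main_containment I w f h m r hr hm hw hwJ.1 hwJ.2
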